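/- Fix t ∈ ℝ^d and 1 ≤ i ≤ d. The map s ↦ ν_s(C) is differentiable for every cylinder C, and there is a constant K = K(t) < ∞, independent of n and of the cylinder, such that for every n ≥ 1 and every cylinder C = [c₀,…,c_{n−1}]: | ∂ν_s(C)/∂s_i |_{s=t} − ∫_C ( S_n f_i − n ∫ f_i dμ_t ) dν_t | ≤ K · ν_t(C). -/

import Mathlib

open MeasureTheory Filter

namespace GibbsPaper

/-- Prepend a symbol to a one-sided sequence. -/
def cons {a : ℕ} (i : Fin a) (x : ℕ → Fin a) : ℕ → Fin a
  | 0 => i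
  | n + 1 => x n

/-- The left shift on sequence space. -/
def shift {a : ℕ} (x : ℕ → Fin a) : ℕ → Fin a := fun n => x (n + 1)

/-- The subshift of finite type determined by the incidence matrix `A`. -/
def SFT {a : ℕ} (A : Fin a → Fin a → Bool) : Set (ℕ → Fin a) :=
  {x | ∀ n, A (x n) (x (n + 1)) = true}

/-- Topological mixing of the subshift, phrased via admissible connecting words. -/
def Mixing {a : ℕ} (A : Fin a → Fin a → Bool) : Prop :=
  ∃ N : ℕ, ∀ n ≥ N, ∀ i j : Fin a, ∃ w : ℕ → Fin a,
    w 0 = i ∧ w n = j ∧ ∀ k < n, A (w k) (w (k + 1)) = true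

/-- Birkhoff sum `S_n h = ∑_{k<n} h ∘ σ^k`. -/
def birkhoff {a : ℕ} (n : ℕ) (h : (ℕ → Fin a) → ℝ) (x : ℕ → Fin a) : ℝ :=
  ∑ k ∈ Finset.range n, h (shift^[k] x)

/-- Hölder continuity with respect to the cylinder (product) structure. -/
def HolderSeq {a : ℕ} (f : (ℕ → Fin a) → ℝ) : Prop :=
  Continuous f ∧ ∃ C ρ : ℝ, 0 < ρ ∧ ρ < 1 ∧
    ∀ n : ℕ, ∀ x y : ℕ → Fin a, (∀ i < n, x i = y i) → |f x - f y| ≤ C * ρ ^ n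

/-- The cylinder `[c₀,…,c_{n-1}]` inside the subshift `Ω = SFT A`. -/
def cyl {a : ℕ} (A : Fin a → Fin a → Bool) (n : ℕ) (c : ℕ → Fin a) : Set (ℕ → Fin a) :=
  {x ∈ SFT A | ∀ i < n, x i = c i}

/-- The Ruelle transfer operator `L_F g (x) = ∑_{σ y = x} e^{F y} g y`. -/
noncomputable def transfer {a : ℕ} (A : Fin a → Fin a → Bool)
    (F g : (ℕ → Fin a) → ℝ) (x : ℕ → Fin a) : ℝ :=
  ∑ i : Fin a, if A i (x 0) = true then Real.exp (F (cons i x)) * g (cons i x) else 0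

/-- `ν` is a probability eigenmeasure of the dual transfer operator `L_F^*` with
eigenvalue `lam`, supported on the subshift. -/
def Eigenmeasure {a : ℕ} (A : Fin a → Fin a → Bool) (F : (ℕ → Fin a) → ℝ)
    (lam : ℝ) (ν : Measure (ℕ → Fin a)) : Prop :=
  IsProbabilityMeasure ν ∧ ν (SFT A)ᶜ = 0 ∧
    ∀ g : (ℕ → Fin a) → ℝ, Continuous g →
      ∫ x, transfer A F g x ∂ν = lam * ∫ x, g x ∂ν

/-- The thermodynamic data on a subshift of finite type: for every Hölder continuous
potential `F`, the pressure `P F`, the Gibbs eigenmeasure `ν F` (the unique probability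
measure with `L_F^* ν = e^{P F} ν`) and the positive Hölder continuous eigenfunction
`φ F` with `L_F (φ F) = e^{P F} φ F`, `∫ φ F dν F = 1`. -/
structure GibbsData (a : ℕ) (A : Fin a → Fin a → Bool) where
  P : ((ℕ → Fin a) → ℝ) → ℝ
  ν : ((ℕ → Fin a) → ℝ) → Measure (ℕ → Fin a)
  φ : ((ℕ → Fin a) → ℝ) → (ℕ → Fin a) → ℝ
  eigen : ∀ F, HolderSeq F → Eigenmeasure A F (Real.exp (P F)) (ν F)
  unique : ∀ F, HolderSeq F → ∀ lam ν', Eigenmeasure A F lam ν' →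
    lam = Real.exp (P F) ∧ ν' = ν F
  φ_holder : ∀ F, HolderSeq F → HolderSeq (φ F)
  φ_pos : ∀ F, HolderSeq F → ∀ x ∈ SFT A, 0 < φ F x
  φ_eigen : ∀ F, HolderSeq F → ∀ x ∈ SFT A,
    transfer A F (φ F) x = Real.exp (P F) * φ F x
  φ_norm : ∀ F, HolderSeq F → ∫ x, φ F x ∂(ν F) = 1

/-- The shift-invariant Gibbs measure `μ_F = φ_F ν_F`. -/
noncomputable def GibbsData.μ {a : ℕ} {A : Fin a → Fin a → Bool} (G : GibbsData a A)
    (F : (ℕ → Fin a) → ℝ) : Measure (ℕ → Fin a) :=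
  (G.ν F).withDensity (fun x => ENNReal.ofReal (G.φ F x))

/-- The linearly parametrized potential `F_t = f₀ + ∑ i, t i • f i`. -/
def Fpot {a d : ℕ} (f₀ : (ℕ → Fin a) → ℝ) (f : Fin d → (ℕ → Fin a) → ℝ)
    (t : Fin d → ℝ) : (ℕ → Fin a) → ℝ :=
  fun x => f₀ x + ∑ i : Fin d, t i * f i x

/-- The vector `F⃗ = (f₀, f₁, …, f_d)`. -/
def Fvec {a d : ℕ} (f₀ : (ℕ → Fin a) → ℝ) (f : Fin d → (ℕ → Fin a) → ℝ) :
    Fin (d + 1) → (ℕ → Fin a) → ℝ :=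
  Fin.cons f₀ f

/-- `Covμ μ f g c` : the asymptotic covariance
`lim (1/m) ∫ S_m(f - ∫ f dμ) S_m(g - ∫ g dμ) dμ` exists and equals `c`. -/
def Covμ {a : ℕ} (μ : Measure (ℕ → Fin a)) (f g : (ℕ → Fin a) → ℝ) (c : ℝ) : Prop :=
  Tendsto (fun m : ℕ => (1 / (m : ℝ)) *
      ∫ x, birkhoff m (fun y => f y - ∫ z, f z ∂μ) x *
        birkhoff m (fun y => g y - ∫ z, g z ∂μ) x ∂μ)
    atTop (nhds c)

/-- `f` and `g` are cohomologous (on the subshift): `g - f = c + h - h∘σ`. -/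
def Cohomologous {a : ℕ} (A : Fin a → Fin a → Bool) (f g : (ℕ → Fin a) → ℝ) : Prop :=
  ∃ c : ℝ, ∃ h : (ℕ → Fin a) → ℝ, Continuous h ∧
    ∀ x ∈ SFT A, g x - f x = c + h x - h (shift x)

/-- `(f₁,…,f_d)` is linearly independent as cohomology classes. -/
def LinIndepCohom {a d : ℕ} (A : Fin a → Fin a → Bool)
    (f : Fin d → (ℕ → Fin a) → ℝ) : Prop :=
  ∀ s : Fin d → ℝ,
    Cohomologous A (fun _ => 0) (fun x => ∑ i : Fin d, s i * f i x) → s = 0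

/-- The supremum of the Birkhoff sum `S_n g` over the cylinder `[c₀,…,c_{n-1}]`. -/
noncomputable def supCyl {a : ℕ} (A : Fin a → Fin a → Bool) (n : ℕ)
    (g : (ℕ → Fin a) → ℝ) (c : ℕ → Fin a) : ℝ :=
  sSup (birkhoff n g '' cyl A n c)

/-- The constraint set `Θ_n^η(x)` of Definition 2.1. -/
noncomputable def ThetaSet {a d : ℕ} (A : Fin a → Fin a → Bool)
    (G : GibbsData a A) (f₀ : (ℕ → Fin a) → ℝ) (f : Fin d → (ℕ → Fin a) → ℝ)
    (Θ : Set (Fin d → ℝ)) (η : ℝ) (n : ℕ) (x : ℕ → Fin a) : Set (Fin d → ℝ) :=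
  {s ∈ Θ | (∀ i : Fin d, |s i| ≤ 1 / η) ∧
    ∀ i : Fin (d + 1),
      |(1 / (n : ℝ)) * supCyl A n (Fvec f₀ f i) x -
        ∫ z, Fvec f₀ f i z ∂(G.μ (Fpot f₀ f s))| ≤ η ^ 2}

/-- `est` is an `η`-maximum likelihood estimator at stage `n` for the data `x`:
it lies in `Θ_n^η(x)` and maximizes `s ↦ ν_s([x₀,…,x_{n-1}])` over `Θ_n^η(x)`. -/
def IsMLE {a d : ℕ} (A : Fin a → Fin a → Bool) (G : GibbsData a A)
    (f₀ : (ℕ → Fin a) → ℝ) (f : Fin d → (ℕ → Fin a) → ℝ) (Θ : Set (Fin d → ℝ))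
    (η : ℝ) (n : ℕ) (x : ℕ → Fin a) (est : Fin d → ℝ) : Prop :=
  est ∈ ThetaSet A G f₀ f Θ η n x ∧
    ∀ s ∈ ThetaSet A G f₀ f Θ η n x,
      G.ν (Fpot f₀ f s) (cyl A n x) ≤ G.ν (Fpot f₀ f est) (cyl A n x)

/-- Weak convergence of a sequence of measures, tested against bounded continuous
functions. -/
def WeakTendsto {E : Type*} [TopologicalSpace E] [MeasurableSpace E]
    (μs : ℕ → Measure E) (μ : Measure E) : Prop :=
  ∀ g : BoundedContinuousFunction E ℝ,
    Tendsto (fun n => ∫ x, g x ∂(μs n)) atTop (nhds (∫ x, g x ∂μ))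

/-- `γ` is the centered `d`-dimensional Gaussian distribution with covariance
matrix `Σ`, characterized through its one-dimensional projections. -/
def IsCenteredGaussian {d : ℕ} (S : Matrix (Fin d) (Fin d) ℝ)
    (γ : Measure (Fin d → ℝ)) : Prop :=
  IsProbabilityMeasure γ ∧
    ∀ l : Fin d → ℝ,
      γ.map (fun x => ∑ i : Fin d, l i * x i) =
        ProbabilityTheory.gaussianReal 0
          (∑ i : Fin d, ∑ j : Fin d, l i * S i j * l j).toNNReal

/-- The random matrix `G(M) = MᵗM − Σ` of Theorem 2.8. -/
noncomputable def Gmat {d : ℕ} (S : Matrix (Fin d) (Fin d) ℝ) (M : Fin d → ℝ) :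
    Matrix (Fin d) (Fin d) ℝ :=
  Matrix.vecMulVec M M - S

/-- The limiting random vector `G⁻¹(N)Nᵗ`. -/
noncomputable def limitVec {d : ℕ} (S : Matrix (Fin d) (Fin d) ℝ) (M : Fin d → ℝ) :
    Fin d → ℝ :=
  (Gmat S M)⁻¹.mulVec M

end GibbsPaper

namespace GibbsPaper

open scoped Topology

section WeakStarDerivative

/-- If `w` vanishes at `t` and is differentiable there, and the functionals `ν s` are uniformly
bounded and converge pointwise to `ν t`, then `s ↦ ν s (w s)` is differentiable at `t`. -/
theorem hasFDerivAt_apply_of_eq_zero {ι E : Type*} [Fintype ι]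
    [NormedAddCommGroup E] [NormedSpace ℝ E] {ν : (ι → ℝ) → E →L[ℝ] ℝ} {t : ι → ℝ} {K : ℝ}
    (hK : ∀ s, ‖ν s‖ ≤ K) (hν : ∀ e, Tendsto (fun s => ν s e) (𝓝 t) (𝓝 (ν t e)))
    {w : (ι → ℝ) → E} {w' : (ι → ℝ) →L[ℝ] E} (hw : HasFDerivAt w w' t) (hwt : w t = 0) :
    HasFDerivAt (fun s => ν s (w s)) ((ν t).comp w') t := by
  classical
  have hK0 : 0 ≤ K := (norm_nonneg _).trans (hK t)
  rw [hasFDerivAt_iff_isLittleO] at hw ⊢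
  have h1 : (fun s => ν s (w s - w t - w' (s - t))) =o[𝓝 t] fun s => s - t := by
    refine Asymptotics.IsBigO.trans_isLittleO ?_ hw
    refine Asymptotics.IsBigO.of_bound K (Eventually.of_forall fun s => ?_)
    exact (ν s).le_of_opNorm_le (hK s) _
  have h2 : (fun s => (ν s - ν t) (w' (s - t))) =o[𝓝 t] fun s => s - t := by
    have hsum : (fun s => (ν s - ν t) (w' (s - t))) =
        fun s => ∑ j, (s - t) j * ((ν s - ν t) (w' (Pi.single j 1))) := by
      funext s
      conv_lhs => rw [pi_eq_sum_univ' (s - t)]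
      simp only [map_sum, map_smul, smul_eq_mul]
    rw [hsum]
    refine Asymptotics.IsLittleO.fun_sum fun j _ => ?_
    have ha : (fun s : ι → ℝ => (s - t) j) =O[𝓝 t] fun s => s - t :=
      Asymptotics.IsBigO.of_bound 1 (Eventually.of_forall fun s => by
        simpa using norm_le_pi_norm (s - t) j)
    have hb : (fun s => (ν s - ν t) (w' (Pi.single j 1))) =o[𝓝 t] fun _ => (1 : ℝ) := by
      rw [Asymptotics.isLittleO_one_iff]
      simpa using (hν (w' (Pi.single j 1))).sub_const (ν t (w' (Pi.single j 1)))
    have hc := ha.norm_right.mul_isLittleO hb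
    simp only [mul_one] at hc
    exact hc.of_norm_right
  refine (h1.add h2).congr_left fun s => ?_
  simp only [hwt, map_sub, ContinuousLinearMap.comp_apply, sub_apply, map_zero]
  ring

end WeakStarDerivative

section Subshift

variable {a : ℕ} {A : Fin a → Fin a → Bool}

theorem isClosed_SFT (A : Fin a → Fin a → Bool) : IsClosed (SFT A) := by
  have : SFT A = ⋂ n, (fun x : ℕ → Fin a => (x n, x (n + 1))) ⁻¹'
      {p | A p.1 p.2 = true} := by
    ext x; simp [SFT]
  rw [this]
  exact isClosed_iInter fun n => (isClosed_discrete _).preimage (by fun_prop)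

instance : CompactSpace (SFT A) := isCompact_iff_compactSpace.mp (isClosed_SFT A).isCompact

theorem continuous_coord (n : ℕ) : Continuous fun x : SFT A => x.1 n :=
  (continuous_apply n).comp continuous_subtype_val

theorem cons_mem_SFT {i : Fin a} {x : ℕ → Fin a} (hx : x ∈ SFT A) (h : A i (x 0) = true) :
    cons i x ∈ SFT A := by
  intro n
  cases n with
  | zero => exact h
  | succ n => exact hx n

open Classical in
/-- The inverse branch `x ↦ i x` of the shift, extended by the identity where `i x` is not
admissible. -/
noncomputable def branch (A : Fin a → Fin a → Bool) (i : Fin a) : C(SFT A, SFT A) where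
  toFun x := if h : A i (x.1 0) = true then ⟨cons i x.1, cons_mem_SFT x.2 h⟩ else x
  continuous_toFun := by
    rw [continuous_induced_rng, continuous_pi_iff]
    intro n
    let H : Fin a × Fin a × Fin a → Fin a := fun p =>
      if A i p.1 = true then (if n = 0 then i else p.2.1) else p.2.2
    have hH : Continuous fun x : SFT A => H (x.1 0, x.1 (n - 1), x.1 n) :=
      (continuous_of_discreteTopology (f := H)).comp ((continuous_coord 0).prodMk
        ((continuous_coord (n - 1)).prodMk (continuous_coord n)))
    refine hH.congr fun x => ?_
    by_cases h : A i (x.1 0) = true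
    · cases n <;> simp [H, h, cons]
    · simp [H, h]

theorem branch_val {i : Fin a} {x : SFT A} (h : A i (x.1 0) = true) :
    (branch A i x).1 = cons i x.1 := by
  simp [branch, h]

/-- The indicator of the set of points to which the symbol `i` can be prepended. -/
noncomputable def admissible (A : Fin a → Fin a → Bool) (i : Fin a) : C(SFT A, ℝ) where
  toFun x := if A i (x.1 0) = true then 1 else 0
  continuous_toFun :=
    (continuous_of_discreteTopology (f := fun j : Fin a => if A i j = true then (1 : ℝ) else 0)).comp
      (continuous_coord 0)

/-- The transfer operator with weight `ψ`, acting on `C(Ω)`. -/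
noncomputable def transferC (ψ : C(SFT A, ℝ)) : C(SFT A, ℝ) →L[ℝ] C(SFT A, ℝ) :=
  ∑ i, (ContinuousLinearMap.mul ℝ C(SFT A, ℝ) (admissible A i)).comp
    ((ContinuousMap.compCLM ℝ ℝ (branch A i)).comp (ContinuousLinearMap.mul ℝ C(SFT A, ℝ) ψ))

theorem transferC_apply (ψ g : C(SFT A, ℝ)) (x : SFT A) :
    transferC ψ g x =
      ∑ i, if A i (x.1 0) = true then ψ (branch A i x) * g (branch A i x) else 0 := by
  simp [transferC, admissible, ContinuousMap.sum_apply]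

theorem transferC_eq_one (ψ g : C(SFT A, ℝ)) : transferC ψ g = transferC 1 (ψ * g) := by
  ext x; simp [transferC_apply]

theorem transferC_smul (r : ℝ) (ψ : C(SFT A, ℝ)) : transferC (r • ψ) = r • transferC ψ := by
  ext g x
  simp [transferC_apply, Finset.mul_sum, mul_assoc]

theorem transferC_nonneg {ψ g : C(SFT A, ℝ)} (hψ : ∀ x, 0 ≤ ψ x) (hg : ∀ x, 0 ≤ g x)
    (x : SFT A) : 0 ≤ transferC ψ g x := by
  rw [transferC_apply]
  refine Finset.sum_nonneg fun i _ => ?_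
  split_ifs
  · exact mul_nonneg (hψ _) (hg _)
  · exact le_rfl

/-- The shift map on the subshift. -/
def shiftC (A : Fin a → Fin a → Bool) : C(SFT A, SFT A) where
  toFun x := ⟨shift x.1, fun n => x.2 (n + 1)⟩
  continuous_toFun := by
    rw [continuous_induced_rng, continuous_pi_iff]
    exact fun n => continuous_coord (n + 1)

theorem shiftC_branch {i : Fin a} {x : SFT A} (h : A i (x.1 0) = true) :
    shiftC A (branch A i x) = x := by
  apply Subtype.ext
  change shift (branch A i x).1 = x.1
  rw [branch_val h]
  rfl

theorem branch_shiftC (x : SFT A) : branch A (x.1 0) (shiftC A x) = x := by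
  apply Subtype.ext
  rw [branch_val (x.2 0)]
  funext n
  cases n <;> rfl

theorem transferC_comp_shiftC_mul (ψ u g : C(SFT A, ℝ)) :
    transferC ψ (u.comp (shiftC A) * g) = u * transferC ψ g := by
  ext x
  simp only [transferC_apply, ContinuousMap.mul_apply, ContinuousMap.comp_apply, Finset.mul_sum]
  refine Finset.sum_congr rfl fun i _ => ?_
  split_ifs with h
  · rw [shiftC_branch h]; ring
  · simp

theorem mul_le_transferC_shiftC {ψ g : C(SFT A, ℝ)} (hψ : ∀ x, 0 ≤ ψ x) (hg : ∀ x, 0 ≤ g x)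
    (x : SFT A) : ψ x * g x ≤ transferC ψ g (shiftC A x) := by
  rw [transferC_apply]
  have h0 : A (x.1 0) ((shiftC A x).1 0) = true := x.2 0
  refine le_trans (le_of_eq ?_) (Finset.single_le_sum (fun i _ => ?_) (Finset.mem_univ (x.1 0)))
  · rw [if_pos h0, branch_shiftC]
  · split_ifs
    · exact mul_nonneg (hψ _) (hg _)
    · exact le_rfl

end Subshift

section Cone

variable {a : ℕ} {A : Fin a → Fin a → Bool}

/-- The cone of nonnegative functions `g` whose logarithm varies by at most `B * ρ ^ k` between
points agreeing on their first `k` coordinates, for every `k > n`. -/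
structure LogHolderCone (ρ B : ℝ) (n : ℕ) (g : C(SFT A, ℝ)) : Prop where
  nonneg : ∀ x, 0 ≤ g x
  le : ∀ k, n < k → ∀ x y : SFT A, (∀ j < k, x.1 j = y.1 j) → g x ≤ g y * Real.exp (B * ρ ^ k)

namespace LogHolderCone

variable {ρ B B' C : ℝ} {n : ℕ} {g ψ : C(SFT A, ℝ)}

theorem mono (hρ : 0 ≤ ρ) (hB : B ≤ B') (hg : LogHolderCone ρ B n g) :
    LogHolderCone ρ B' n g where
  nonneg := hg.nonneg
  le k hk x y hxy := (hg.le k hk x y hxy).trans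
    (mul_le_mul_of_nonneg_left (Real.exp_le_exp.2 (by gcongr)) (hg.nonneg y))

theorem of_locallyConstant (hρ : 0 ≤ ρ) (hB : 0 ≤ B) (h0 : ∀ x, 0 ≤ g x)
    (hg : ∀ x y : SFT A, (∀ j < n, x.1 j = y.1 j) → g x = g y) : LogHolderCone ρ B n g where
  nonneg := h0
  le k hk x y hxy := by
    rw [hg x y fun j hj => hxy j (hj.trans hk)]
    exact le_mul_of_one_le_right (h0 y) (Real.one_le_exp (by positivity))

theorem one (hρ : 0 ≤ ρ) (hB : 0 ≤ B) : LogHolderCone ρ B 0 (1 : C(SFT A, ℝ)) :=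
  of_locallyConstant hρ hB (fun _ => zero_le_one) fun _ _ _ => rfl

theorem of_holder (hρ : 0 ≤ ρ) {c D : ℝ} (hc : 0 < c) (hD : 0 ≤ D) (hcg : ∀ x, c ≤ g x)
    (hg : ∀ k, ∀ x y : SFT A, (∀ j < k, x.1 j = y.1 j) → |g x - g y| ≤ D * ρ ^ k)
    (hB : D / c ≤ B) : LogHolderCone ρ B n g where
  nonneg x := hc.le.trans (hcg x)
  le k _ x y hxy := by
    have hy : 0 ≤ g y := hc.le.trans (hcg y)
    have h1 : g x - g y ≤ D * ρ ^ k := (le_abs_self _).trans (hg k x y hxy)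
    have h2 : D * ρ ^ k ≤ g y * (B * ρ ^ k) := by
      have : D ≤ g y * B := calc
        D = c * (D / c) := by field_simp
        _ ≤ g y * B := mul_le_mul (hcg y) hB (by positivity) hy
      calc D * ρ ^ k ≤ (g y * B) * ρ ^ k := by gcongr
        _ = _ := by ring
    have h3 := mul_le_mul_of_nonneg_left (Real.add_one_le_exp (B * ρ ^ k)) hy
    linarith

theorem map_transferC (hψ0 : ∀ x, 0 ≤ ψ x)
    (hψ : ∀ k, ∀ x y : SFT A, (∀ j < k, x.1 j = y.1 j) → ψ x ≤ ψ y * Real.exp (C * ρ ^ k))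
    (hg : LogHolderCone ρ B n g) :
    LogHolderCone ρ (ρ * (B + C)) (n - 1) (transferC ψ g) where
  nonneg := transferC_nonneg hψ0 hg.nonneg
  le k hk x y hxy := by
    have hx0 : x.1 0 = y.1 0 := hxy 0 (by omega)
    rw [transferC_apply, transferC_apply, Finset.sum_mul]
    refine Finset.sum_le_sum fun i _ => ?_
    rw [hx0]
    split_ifs with h
    · have hbr : ∀ j < k + 1, (branch A i x).1 j = (branch A i y).1 j := by
        intro j hj
        rw [branch_val (by rwa [hx0]), branch_val h]
        cases j with
        | zero => rfl
        | succ j => exact hxy j (by omega)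
      calc ψ (branch A i x) * g (branch A i x)
          ≤ (ψ (branch A i y) * Real.exp (C * ρ ^ (k + 1))) *
            (g (branch A i y) * Real.exp (B * ρ ^ (k + 1))) :=
            mul_le_mul (hψ _ _ _ hbr) (hg.le _ (by omega) _ _ hbr) (hg.nonneg _)
              (mul_nonneg (hψ0 _) (Real.exp_pos _).le)
        _ = ψ (branch A i y) * g (branch A i y) * Real.exp (ρ * (B + C) * ρ ^ k) := by
            rw [show ρ * (B + C) * ρ ^ k = C * ρ ^ (k + 1) + B * ρ ^ (k + 1) by ring, Real.exp_add]
            ring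
    · simp

theorem map_transferC_pow (hρ : 0 ≤ ρ) (hψ0 : ∀ x, 0 ≤ ψ x)
    (hψ : ∀ k, ∀ x y : SFT A, (∀ j < k, x.1 j = y.1 j) → ψ x ≤ ψ y * Real.exp (C * ρ ^ k))
    (hB : ρ * (B + C) ≤ B) (m : ℕ) (hg : LogHolderCone ρ B n g) :
    LogHolderCone ρ B (n - m) ((transferC ψ ^ m) g) := by
  induction m with
  | zero => simpa using hg
  | succ m ih =>
    rw [pow_succ', mul_apply_eq_comp, ← Nat.sub_sub]
    exact (ih.map_transferC hψ0 hψ).mono hρ hB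

/-- Subtracting a small constant from a function in a narrow cone stays in a wider cone. -/
theorem sub_smul_one (hρ : 0 ≤ ρ) (hρ1 : ρ ≤ 1) (hB' : 0 ≤ B') (hB : B' < B) {c : ℝ}
    (hc : 0 ≤ c) (hcg : ∀ x, c ≤ (B - B') / (B * Real.exp B) * g x)
    (hg : LogHolderCone ρ B' 0 g) : LogHolderCone ρ B 0 (g - c • (1 : C(SFT A, ℝ))) := by
  have hB0 : 0 < B := hB'.trans_lt hB
  have hE : 1 ≤ Real.exp B := Real.one_le_exp hB0.le
  refine ⟨fun x => ?_, fun k hk x y hxy => ?_⟩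
  · have : (B - B') / (B * Real.exp B) ≤ 1 := by
      rw [div_le_one (by positivity)]
      nlinarith
    have h2 := mul_le_mul_of_nonneg_right this (hg.nonneg x)
    simp only [ContinuousMap.sub_apply, ContinuousMap.smul_apply, ContinuousMap.one_apply,
      smul_eq_mul]
    linarith [hcg x]
  · simp only [ContinuousMap.sub_apply, ContinuousMap.smul_apply, ContinuousMap.one_apply,
      smul_eq_mul, mul_one]
    set r := ρ ^ k with hr
    have hr0 : 0 ≤ r := by positivity
    have hr1 : r ≤ 1 := pow_le_one₀ hρ hρ1
    have h1 := hg.le k hk x y hxy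
    have hy := hg.nonneg y
    have hlow : (B - B') * r ≤ Real.exp (B * r) - Real.exp (B' * r) := by
      have e1 : Real.exp (B * r) = Real.exp (B' * r) * Real.exp ((B - B') * r) := by
        rw [← Real.exp_add]; ring_nf
      have e2 := Real.add_one_le_exp ((B - B') * r)
      have e3 : 1 ≤ Real.exp (B' * r) := Real.one_le_exp (by positivity)
      have e4 : 0 ≤ (B - B') * r := mul_nonneg (by linarith) hr0
      rw [e1]
      nlinarith
    have hup : Real.exp (B * r) - 1 ≤ B * r * Real.exp B := by
      have e1 := Real.add_one_le_exp (-(B * r))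
      have e2 : Real.exp (B * r) * Real.exp (-(B * r)) = 1 := by rw [← Real.exp_add]; simp
      have e3 : Real.exp (B * r) ≤ Real.exp B := Real.exp_le_exp.2 (by nlinarith)
      have e4 := mul_le_mul_of_nonneg_left e1 (Real.exp_pos (B * r)).le
      have e5 := mul_le_mul_of_nonneg_left e3 (mul_nonneg hB0.le hr0)
      linarith
    have hkey : c * (Real.exp (B * r) - 1) ≤ g y * (Real.exp (B * r) - Real.exp (B' * r)) :=
      calc c * (Real.exp (B * r) - 1) ≤ c * (B * r * Real.exp B) := by gcongr
        _ ≤ ((B - B') / (B * Real.exp B) * g y) * (B * r * Real.exp B) :=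
          mul_le_mul_of_nonneg_right (hcg y) (by positivity)
        _ = g y * ((B - B') * r) := by field_simp
        _ ≤ _ := by gcongr
    linarith

end LogHolderCone

end Cone

section Decay

variable {a : ℕ} {A : Fin a → Fin a → Bool}

theorem shiftC_iterate_val (n : ℕ) (x : SFT A) (k : ℕ) :
    ((shiftC A)^[n] x).1 k = x.1 (k + n) := by
  induction n generalizing x with
  | zero => rfl
  | succ n ih => rw [Function.iterate_succ_apply, ih]; rfl

theorem exists_shiftC_iterate_eq (hmix : Mixing A) :
    ∃ N, 1 ≤ N ∧ ∀ (i : Fin a) (x : SFT A), ∃ y : SFT A, y.1 0 = i ∧ (shiftC A)^[N] y = x := by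
  obtain ⟨N, hN⟩ := hmix
  refine ⟨max N 1, le_max_right _ _, fun i x => ?_⟩
  obtain ⟨w, hw0, hwN, hw⟩ := hN (max N 1) (le_max_left _ _) i (x.1 0)
  have hpos : 0 < max N 1 := by omega
  generalize max N 1 = M at *
  refine ⟨⟨fun k => if k < M then w k else x.1 (k - M), fun k => ?_⟩, ?_, ?_⟩
  · rcases lt_trichotomy (k + 1) M with h | h | h
    · simpa [h, show k < M by omega] using hw k (by omega)
    · subst h
      simpa [hwN] using hw k (by omega)
    · simpa [show ¬ k < M by omega, show ¬ k + 1 < M by omega,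
        show k + 1 - M = k - M + 1 by omega] using x.2 (k - M)
  · simpa [hpos] using hw0
  · apply Subtype.ext
    funext k
    rw [shiftC_iterate_val]
    simp

theorem pow_mul_le_transferC_pow {ψ g : C(SFT A, ℝ)} {m : ℝ} (hm : 0 ≤ m) (hψ : ∀ x, m ≤ ψ x)
    (hg : ∀ x, 0 ≤ g x) (n : ℕ) :
    (∀ x, 0 ≤ (transferC ψ ^ n) g x) ∧
      ∀ x, m ^ n * g x ≤ (transferC ψ ^ n) g ((shiftC A)^[n] x) := by
  have hψ0 : ∀ x, 0 ≤ ψ x := fun x => hm.trans (hψ x)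
  induction n with
  | zero => simpa using hg
  | succ n ih =>
    rw [pow_succ' (transferC ψ), mul_apply_eq_comp]
    refine ⟨transferC_nonneg hψ0 ih.1, fun x => ?_⟩
    rw [Function.iterate_succ_apply']
    refine le_trans ?_ (mul_le_transferC_shiftC hψ0 ih.1 _)
    rw [pow_succ', mul_assoc]
    exact mul_le_mul (hψ _) (ih.2 x) (mul_nonneg (by positivity) (hg x)) (hψ0 _)

/-- Data of a positive log-Hölder weight `ψ` together with a positive normalized functional `ℓ`
fixed by the dual of the transfer operator of `ψ`, and cone parameters `ρ`, `B` for which the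
cone is contracted. -/
structure NormalizedTransfer (A : Fin a → Fin a → Bool) (ψ : C(SFT A, ℝ))
    (ℓ : C(SFT A, ℝ) →L[ℝ] ℝ) (ρ B : ℝ) : Prop where
  ρ_pos : 0 < ρ
  ρ_lt : ρ < 1
  weight : ∃ m, 0 < m ∧ ∀ x, m ≤ ψ x
  logHolder : ∃ C, 0 ≤ C ∧ ρ * (B + C) < B ∧
    ∀ k, ∀ x y : SFT A, (∀ j < k, x.1 j = y.1 j) → ψ x ≤ ψ y * Real.exp (C * ρ ^ k)
  pos : ∀ g : C(SFT A, ℝ), (∀ x, 0 ≤ g x) → 0 ≤ ℓ g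
  one : ℓ 1 = 1
  invariant : ∀ g, ℓ (transferC ψ g) = ℓ g

namespace NormalizedTransfer

variable {ψ : C(SFT A, ℝ)} {ℓ : C(SFT A, ℝ) →L[ℝ] ℝ} {ρ B : ℝ}

theorem weight_nonneg (h : NormalizedTransfer A ψ ℓ ρ B) (x : SFT A) : 0 ≤ ψ x := by
  obtain ⟨m, hm, hψ⟩ := h.weight
  exact hm.le.trans (hψ x)

theorem B_pos (h : NormalizedTransfer A ψ ℓ ρ B) : 0 < B := by
  obtain ⟨C, hC, hB, -⟩ := h.logHolder
  have h1 := h.ρ_pos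
  have h2 := h.ρ_lt
  have := mul_nonneg h1.le hC
  by_contra! hneg
  nlinarith

theorem mono (h : NormalizedTransfer A ψ ℓ ρ B) {u v : C(SFT A, ℝ)} (huv : ∀ x, u x ≤ v x) :
    ℓ u ≤ ℓ v := by
  have := h.pos (v - u) fun x => by simpa using huv x
  rw [map_sub] at this
  linarith

theorem invariant_pow (h : NormalizedTransfer A ψ ℓ ρ B) (n : ℕ) (g : C(SFT A, ℝ)) :
    ℓ ((transferC ψ ^ n) g) = ℓ g := by
  induction n with
  | zero => simp
  | succ n ih => rw [pow_succ', mul_apply_eq_comp, h.invariant, ih]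

theorem cone_pow (h : NormalizedTransfer A ψ ℓ ρ B) {n : ℕ} {g : C(SFT A, ℝ)}
    (hg : LogHolderCone ρ B n g) (m : ℕ) : LogHolderCone ρ B (n - m) ((transferC ψ ^ m) g) := by
  obtain ⟨C, hC, hB, hψ⟩ := h.logHolder
  exact hg.map_transferC_pow h.ρ_pos.le h.weight_nonneg hψ hB.le m

theorem cone_pow_zero (h : NormalizedTransfer A ψ ℓ ρ B) {g : C(SFT A, ℝ)}
    (hg : LogHolderCone ρ B 0 g) (m : ℕ) : LogHolderCone ρ B 0 ((transferC ψ ^ m) g) := by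
  simpa using h.cone_pow hg m

theorem exists_le_pow (h : NormalizedTransfer A ψ ℓ ρ B) (hmix : Mixing A) :
    ∃ N, 1 ≤ N ∧ ∃ δ, 0 < δ ∧ ∀ g, LogHolderCone ρ B 0 g →
      ∀ z x, δ * g z ≤ (transferC ψ ^ N) g x := by
  obtain ⟨N, hN1, hN⟩ := exists_shiftC_iterate_eq hmix
  obtain ⟨m, hm, hψ⟩ := h.weight
  refine ⟨N, hN1, m ^ N * Real.exp (-B), by positivity, fun g hg z x => ?_⟩
  obtain ⟨y, hy0, hyx⟩ := hN (z.1 0) x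
  have h1 := (pow_mul_le_transferC_pow hm.le hψ hg.nonneg N).2 y
  rw [hyx] at h1
  refine le_trans ?_ h1
  rw [mul_assoc]
  refine mul_le_mul_of_nonneg_left ?_ (by positivity)
  have h2 := hg.le 1 one_pos z y fun j hj => by
    obtain rfl : j = 0 := by omega
    exact hy0.symm
  have h3 : Real.exp (B * ρ ^ 1) ≤ Real.exp B := Real.exp_le_exp.2 (by
    nlinarith [h.B_pos, h.ρ_lt])
  rw [Real.exp_neg, inv_mul_le_iff₀ (Real.exp_pos _), mul_comm]
  exact h2.trans (mul_le_mul_of_nonneg_left h3 (hg.nonneg y))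

/-- Exponential decay: two functions of the cone with the same `ℓ`-mass are merged
exponentially fast by the transfer operator. -/
theorem exists_decay (h : NormalizedTransfer A ψ ℓ ρ B) (hmix : Mixing A) :
    ∃ K θ : ℝ, 0 ≤ K ∧ 0 < θ ∧ θ < 1 ∧ ∀ k, ∀ g₁ g₂ : C(SFT A, ℝ), LogHolderCone ρ B 0 g₁ →
      LogHolderCone ρ B 0 g₂ → ℓ g₁ = ℓ g₂ →
      ‖(transferC ψ ^ k) (g₁ - g₂)‖ ≤ K * θ ^ k * ℓ g₁ := by
  obtain ⟨N, hN1, δ, hδ, hlow⟩ := h.exists_le_pow hmix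
  obtain ⟨C, hC, hB, hψ⟩ := h.logHolder
  have hρ := h.ρ_pos
  have hBp := h.B_pos
  have hsup : ∀ g, LogHolderCone ρ B 0 g → ∀ z, g z ≤ δ⁻¹ * ℓ g := by
    intro g hg z
    have h1 := h.mono (u := (δ * g z) • (1 : C(SFT A, ℝ))) (v := (transferC ψ ^ N) g)
      (fun x => by simpa using hlow g hg z x)
    rw [map_smul, h.one, h.invariant_pow, smul_eq_mul, mul_one] at h1
    rwa [le_inv_mul_iff₀ hδ]
  have hlow' : ∀ g, LogHolderCone ρ B 0 g → ∀ x, δ * ℓ g ≤ (transferC ψ ^ N) g x := by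
    intro g hg x
    have h1 := h.mono (u := δ • g) (v := (transferC ψ ^ N) g x • (1 : C(SFT A, ℝ)))
      (fun z => by simpa using hlow g hg z x)
    simpa [h.one] using h1
  have hmass : ∀ g, LogHolderCone ρ B 0 g → 0 ≤ ℓ g := fun g hg => h.pos g hg.nonneg
  set B' := ρ * (B + C)
  have hB'0 : 0 ≤ B' := by positivity
  set κ := (B - B') / (B * Real.exp B) with hκ
  have hκ0 : 0 < κ := div_pos (by linarith) (by positivity)
  set τ := min (κ * δ) (1 / 2) with hτ
  have hτ0 : 0 < τ := lt_min (by positivity) (by norm_num)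
  have hτ1 : τ ≤ 1 / 2 := min_le_right _ _
  have hstep : ∀ g, LogHolderCone ρ B 0 g →
      LogHolderCone ρ B 0 ((transferC ψ ^ N) g - (τ * ℓ g) • (1 : C(SFT A, ℝ))) := by
    intro g hg
    obtain ⟨M, rfl⟩ : ∃ M, N = M + 1 := ⟨N - 1, by omega⟩
    have hcone : LogHolderCone ρ B' 0 ((transferC ψ ^ (M + 1)) g) := by
      rw [pow_succ', mul_apply_eq_comp]
      exact (h.cone_pow_zero hg M).map_transferC h.weight_nonneg hψ
    refine hcone.sub_smul_one hρ.le h.ρ_lt.le hB'0 hB (mul_nonneg hτ0.le (hmass g hg)) fun x => ?_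
    calc τ * ℓ g ≤ κ * δ * ℓ g := mul_le_mul_of_nonneg_right (min_le_left _ _) (hmass g hg)
      _ = κ * (δ * ℓ g) := by ring
      _ ≤ _ := mul_le_mul_of_nonneg_left (hlow' g hg x) hκ0.le
  set θ := (1 - τ) ^ ((N : ℝ)⁻¹) with hθ
  have hτ' : 0 < 1 - τ := by linarith
  have hθ0 : 0 < θ := Real.rpow_pos_of_pos hτ' _
  have hθ1 : θ < 1 := Real.rpow_lt_one hτ'.le (by linarith) (by positivity)
  have hθN : θ ^ N = 1 - τ := Real.rpow_inv_natCast_pow hτ'.le (by omega)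
  refine ⟨δ⁻¹ * (θ ^ N)⁻¹, θ, by positivity, hθ0, hθ1, fun k => ?_⟩
  induction k using Nat.strong_induction_on with
  | _ k ih =>
    intro g₁ g₂ h1 h2 h12
    rcases lt_or_ge k N with hk | hk
    · have hm := hmass g₁ h1
      have hbase : ‖(transferC ψ ^ k) (g₁ - g₂)‖ ≤ δ⁻¹ * ℓ g₁ := by
        rw [ContinuousMap.norm_le _ (by positivity)]
        intro x
        have a1 := hsup _ (h.cone_pow_zero h1 k) x
        have a2 := hsup _ (h.cone_pow_zero h2 k) x
        have b1 := (h.cone_pow_zero h1 k).nonneg x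
        have b2 := (h.cone_pow_zero h2 k).nonneg x
        rw [h.invariant_pow] at a1 a2
        rw [← h12] at a2
        rw [map_sub, ContinuousMap.sub_apply, Real.norm_eq_abs, abs_le]
        constructor <;> linarith
      refine hbase.trans (mul_le_mul_of_nonneg_right ?_ hm)
      rw [mul_assoc]
      refine le_mul_of_one_le_right (by positivity) ?_
      rw [one_le_inv_mul₀ (by positivity)]
      exact pow_le_pow_of_le_one hθ0.le hθ1.le hk.le
    · obtain ⟨j, rfl⟩ : ∃ j, k = j + N := ⟨k - N, by omega⟩
      have hmass' : ∀ g, ℓ ((transferC ψ ^ N) g - (τ * ℓ g) • (1 : C(SFT A, ℝ))) =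
          (1 - τ) * ℓ g := by
        intro g
        rw [map_sub, map_smul, h.one, h.invariant_pow, smul_eq_mul]
        ring
      have key := ih j (by omega) _ _ (hstep g₁ h1) (hstep g₂ h2) (by rw [hmass', hmass', h12])
      rw [hmass', h12, sub_sub_sub_cancel_right, ← map_sub, ← mul_apply_eq_comp,
        ← pow_add] at key
      refine key.trans (le_of_eq ?_)
      rw [h12, ← hθN, pow_add]
      ring

end NormalizedTransfer

end Decay

section Poisson

variable {a : ℕ} {A : Fin a → Fin a → Bool} {ψ : C(SFT A, ℝ)} {ℓ : C(SFT A, ℝ) →L[ℝ] ℝ}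
  {ρ B K θ : ℝ}

namespace NormalizedTransfer

/-- `K * θ ^ k` is an exponential rate at which the transfer operator merges functions of the cone
with the same mass. -/
structure DecayRate (ψ : C(SFT A, ℝ)) (ℓ : C(SFT A, ℝ) →L[ℝ] ℝ) (ρ B K θ : ℝ) : Prop where
  K_nonneg : 0 ≤ K
  θ_pos : 0 < θ
  θ_lt : θ < 1
  decay : ∀ k, ∀ g₁ g₂ : C(SFT A, ℝ), LogHolderCone ρ B 0 g₁ →
      LogHolderCone ρ B 0 g₂ → ℓ g₁ = ℓ g₂ →
      ‖(transferC ψ ^ k) (g₁ - g₂)‖ ≤ K * θ ^ k * ℓ g₁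

theorem norm_pow_centered_le (h : NormalizedTransfer A ψ ℓ ρ B) (hd : DecayRate ψ ℓ ρ B K θ)
    {n : ℕ} {g : C(SFT A, ℝ)} (hg : LogHolderCone ρ B n g) (k : ℕ) :
    ‖(transferC ψ ^ (k + n)) (g - ℓ g • (1 : C(SFT A, ℝ)))‖ ≤ 2 * K * ℓ g * θ ^ k := by
  have hm : 0 ≤ ℓ g := h.pos g hg.nonneg
  have hone : LogHolderCone ρ B 0 (1 : C(SFT A, ℝ)) := .one h.ρ_pos.le h.B_pos.le
  have hconst : LogHolderCone ρ B 0 (ℓ g • (1 : C(SFT A, ℝ))) :=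
    .of_locallyConstant h.ρ_pos.le h.B_pos.le (fun x => by simpa using hm) fun _ _ _ => rfl
  have hgn : LogHolderCone ρ B 0 ((transferC ψ ^ n) g) := by simpa using h.cone_pow hg n
  have e1 := hd.decay k _ _ hgn hconst (by rw [h.invariant_pow, map_smul, h.one, smul_eq_mul, mul_one])
  have e2 := hd.decay k _ _ (h.cone_pow_zero hone n) hone (h.invariant_pow n 1)
  rw [h.invariant_pow] at e1 e2
  have hsplit : (transferC ψ ^ (k + n)) (g - ℓ g • (1 : C(SFT A, ℝ))) =
      (transferC ψ ^ k) ((transferC ψ ^ n) g - ℓ g • (1 : C(SFT A, ℝ))) -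
        ℓ g • (transferC ψ ^ k) ((transferC ψ ^ n) 1 - 1) := by
    simp only [pow_add, mul_apply_eq_comp, map_sub, map_smul, smul_sub]
    abel
  rw [hsplit]
  refine (norm_sub_le _ _).trans ?_
  rw [norm_smul, Real.norm_of_nonneg hm]
  rw [h.one, mul_one] at e2
  have e3 := mul_le_mul_of_nonneg_left e2 hm
  linarith

theorem summable_pow_centered (h : NormalizedTransfer A ψ ℓ ρ B) (hd : DecayRate ψ ℓ ρ B K θ)
    {n : ℕ} {g : C(SFT A, ℝ)} (hg : LogHolderCone ρ B n g) :
    Summable fun k => (transferC ψ ^ k) (g - ℓ g • (1 : C(SFT A, ℝ))) := by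
  rw [← summable_nat_add_iff n]
  exact Summable.of_norm_bounded
    ((summable_geometric_of_lt_one hd.θ_pos.le hd.θ_lt).mul_left (2 * K * ℓ g))
    (h.norm_pow_centered_le hd hg)

/-- The solution `h` of the Poisson equation `h - L h = g - ℓ g`, as a Neumann series. -/
noncomputable def poisson (ψ : C(SFT A, ℝ)) (ℓ : C(SFT A, ℝ) →L[ℝ] ℝ) (g : C(SFT A, ℝ)) :
    C(SFT A, ℝ) :=
  ∑' k, (transferC ψ ^ k) (g - ℓ g • (1 : C(SFT A, ℝ)))

theorem poisson_sub (h : NormalizedTransfer A ψ ℓ ρ B) (hd : DecayRate ψ ℓ ρ B K θ)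
    {n : ℕ} {g : C(SFT A, ℝ)} (hg : LogHolderCone ρ B n g) :
    poisson ψ ℓ g - transferC ψ (poisson ψ ℓ g) = g - ℓ g • (1 : C(SFT A, ℝ)) := by
  have hs := h.summable_pow_centered hd hg
  have h1 : poisson ψ ℓ g = _ := hs.tsum_eq_zero_add
  have h2 : transferC ψ (poisson ψ ℓ g) =
      ∑' k, (transferC ψ ^ (k + 1)) (g - ℓ g • (1 : C(SFT A, ℝ))) := by
    rw [poisson, (transferC ψ).map_tsum hs]
    simp only [pow_succ', mul_apply_eq_comp]
  rw [h2, h1]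
  simp

/-- A functional `T` killing the eigenfunction, evaluated at the solution of the Poisson equation,
is given by the first `n` terms of the Neumann series up to an error bounded by the mass. -/
theorem abs_apply_poisson_sub_le (h : NormalizedTransfer A ψ ℓ ρ B) (hd : DecayRate ψ ℓ ρ B K θ)
    {φ : C(SFT A, ℝ)} (hφ : LogHolderCone ρ B 0 φ) (hφψ : transferC ψ φ = φ) (hφℓ : ℓ φ = 1)
    {T : C(SFT A, ℝ) →L[ℝ] ℝ} (hT : T φ = 0)
    {n : ℕ} {g : C(SFT A, ℝ)} (hg : LogHolderCone ρ B n g) :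
    |T (poisson ψ ℓ g) - ∑ k ∈ Finset.range n, T ((transferC ψ ^ k) g)| ≤
      ‖T‖ * (3 * K * (1 - θ)⁻¹) * ℓ g := by
  have hm : 0 ≤ ℓ g := h.pos g hg.nonneg
  have hK := hd.K_nonneg
  have hθ := hd.θ_pos
  have hs := h.summable_pow_centered hd hg
  have hφk : ∀ k, (transferC ψ ^ k) φ = φ := by
    intro k
    induction k with
    | zero => simp
    | succ k ih => rw [pow_succ', mul_apply_eq_comp, ih, hφψ]
  have hsT := hs.mapL T
  have hTh : T (poisson ψ ℓ g) =
      ∑' k, T ((transferC ψ ^ k) (g - ℓ g • (1 : C(SFT A, ℝ)))) := T.map_tsum hs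
  rw [hTh, ← hsT.sum_add_tsum_nat_add n]
  have hone : LogHolderCone ρ B 0 (1 : C(SFT A, ℝ)) := .one h.ρ_pos.le h.B_pos.le
  have hhead : |∑ k ∈ Finset.range n, T ((transferC ψ ^ k) 1)| ≤ ‖T‖ * (K * (1 - θ)⁻¹) := by
    have hb : ∀ k, |T ((transferC ψ ^ k) 1)| ≤ ‖T‖ * K * θ ^ k := by
      intro k
      have e1 := hd.decay k 1 φ hone hφ (by rw [h.one, hφℓ])
      rw [h.one, mul_one] at e1
      have e2 : T ((transferC ψ ^ k) 1) = T ((transferC ψ ^ k) (1 - φ)) := by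
        rw [map_sub, map_sub, hφk, hT, sub_zero]
      rw [e2, mul_assoc]
      exact (T.le_opNorm _).trans (mul_le_mul_of_nonneg_left e1 (norm_nonneg _))
    calc _ ≤ ∑ k ∈ Finset.range n, |T ((transferC ψ ^ k) 1)| := Finset.abs_sum_le_sum_abs _ _
      _ ≤ ∑ k ∈ Finset.range n, ‖T‖ * K * θ ^ k := Finset.sum_le_sum fun k _ => hb k
      _ ≤ ∑' k, ‖T‖ * K * θ ^ k :=
        ((summable_geometric_of_lt_one hθ.le hd.θ_lt).mul_left _).sum_le_tsum _
          fun k _ => by positivity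
      _ = ‖T‖ * (K * (1 - θ)⁻¹) := by
        rw [tsum_mul_left, tsum_geometric_of_lt_one hθ.le hd.θ_lt, mul_assoc]
  have htail : |∑' k, T ((transferC ψ ^ (k + n)) (g - ℓ g • (1 : C(SFT A, ℝ))))| ≤
      ‖T‖ * (2 * K * ℓ g) * (1 - θ)⁻¹ := by
    refine tsum_of_norm_bounded (f := fun k => T ((transferC ψ ^ (k + n))
      (g - ℓ g • (1 : C(SFT A, ℝ)))))
      ((hasSum_geometric_of_lt_one hθ.le hd.θ_lt).mul_left (‖T‖ * (2 * K * ℓ g))) fun k => ?_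
    rw [mul_assoc]
    exact (T.le_opNorm _).trans
      (mul_le_mul_of_nonneg_left (h.norm_pow_centered_le hd hg k) (norm_nonneg _))
  have hsum : ∑ k ∈ Finset.range n, T ((transferC ψ ^ k) (g - ℓ g • (1 : C(SFT A, ℝ)))) =
      ∑ k ∈ Finset.range n, T ((transferC ψ ^ k) g) -
        ℓ g * ∑ k ∈ Finset.range n, T ((transferC ψ ^ k) 1) := by
    rw [Finset.mul_sum, ← Finset.sum_sub_distrib]
    simp only [map_sub, map_smul, smul_eq_mul]
  rw [hsum, sub_add_eq_add_sub, add_sub_assoc, add_sub_cancel_left]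
  refine (abs_sub _ _).trans ?_
  rw [abs_mul, abs_of_nonneg hm]
  have := mul_le_mul_of_nonneg_left hhead hm
  linarith

theorem apply_mul_pow (h : NormalizedTransfer A ψ ℓ ρ B) (u g : C(SFT A, ℝ)) (k : ℕ) :
    ℓ (u * (transferC ψ ^ k) g) = ℓ (u.comp ⟨_, (shiftC A).continuous.iterate k⟩ * g) := by
  induction k generalizing g with
  | zero => rfl
  | succ k ih =>
    rw [pow_succ, mul_apply_eq_comp, ih, ← transferC_comp_shiftC_mul, h.invariant]
    rfl

end NormalizedTransfer

end Poisson

section Family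

variable {a : ℕ} {A : Fin a → Fin a → Bool} {ι : Type*} [Fintype ι]

/-- The linear map `v ↦ ∑ i, v i • f i`. -/
noncomputable def linPot (f : ι → C(SFT A, ℝ)) : (ι → ℝ) →L[ℝ] C(SFT A, ℝ) :=
  ∑ i, (ContinuousLinearMap.proj (R := ℝ) (φ := fun _ : ι => ℝ) i).smulRight (f i)

theorem linPot_apply (f : ι → C(SFT A, ℝ)) (v : ι → ℝ) : linPot f v = ∑ i, v i • f i := by
  simp [linPot]

/-- The weight `exp (F₀ + ∑ i, s i • f i)` of the transfer operator at parameter `s`. -/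
noncomputable def expWeight (F₀ : C(SFT A, ℝ)) (f : ι → C(SFT A, ℝ)) (s : ι → ℝ) :
    C(SFT A, ℝ) :=
  NormedSpace.exp (F₀ + linPot f s)

theorem exp_apply (F : C(SFT A, ℝ)) (x : SFT A) :
    (NormedSpace.exp F : C(SFT A, ℝ)) x = Real.exp (F x) := by
  let : NormedAlgebra ℚ C(SFT A, ℝ) := NormedAlgebra.restrictScalars ℚ ℝ _
  rw [Real.exp_eq_exp_ℝ]
  exact NormedSpace.map_exp (ContinuousMap.evalAlgHom ℝ ℝ x) (continuous_eval_const x) F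

theorem exists_hasFDerivAt_transferC (F₀ : C(SFT A, ℝ)) (f : ι → C(SFT A, ℝ)) (t : ι → ℝ)
    (h : C(SFT A, ℝ)) :
    ∃ W : (ι → ℝ) →L[ℝ] C(SFT A, ℝ),
      HasFDerivAt (fun s => transferC (expWeight F₀ f s) h) W t ∧
      ∀ v, W v = transferC (expWeight F₀ f t) (linPot f v * h) := by
  have h1 : HasFDerivAt (fun s => F₀ + linPot f s) (linPot f) t :=
    (linPot f).hasFDerivAt.const_add F₀
  have h2 := (hasFDerivAt_exp (𝕂 := ℝ) (x := F₀ + linPot f t)).comp t h1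
  let M : C(SFT A, ℝ) →L[ℝ] C(SFT A, ℝ) :=
    (transferC 1).comp (ContinuousLinearMap.mul ℝ C(SFT A, ℝ) h)
  have h3 := M.hasFDerivAt.comp t h2
  refine ⟨_, h3.congr_of_eventuallyEq (Eventually.of_forall fun s => ?_), fun v => ?_⟩
  · change transferC (expWeight F₀ f s) h = transferC 1 (h * expWeight F₀ f s)
    rw [transferC_eq_one, mul_comm]
  · change transferC 1 (h * (expWeight F₀ f t * linPot f v)) = _
    rw [transferC_eq_one (expWeight F₀ f t)]
    congr 1
    ring

/-- A family of positive normalized eigenfunctionals of the dual transfer operators. -/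
structure GibbsFamily (F₀ : C(SFT A, ℝ)) (f : ι → C(SFT A, ℝ))
    (ℓ : (ι → ℝ) → C(SFT A, ℝ) →L[ℝ] ℝ) (lam : (ι → ℝ) → ℝ) : Prop where
  pos : ∀ s, ∀ g : C(SFT A, ℝ), (∀ x, 0 ≤ g x) → 0 ≤ ℓ s g
  one : ∀ s, ℓ s 1 = 1
  lam_pos : ∀ s, 0 < lam s
  eigen : ∀ s g, ℓ s (transferC (expWeight F₀ f s) g) = lam s * ℓ s g

/-- A positive eigenfunction `φ` at the parameter `t`, with cone parameters and a decay rate. -/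
structure EigenAt (F₀ : C(SFT A, ℝ)) (f : ι → C(SFT A, ℝ))
    (ℓ : (ι → ℝ) → C(SFT A, ℝ) →L[ℝ] ℝ) (lam : (ι → ℝ) → ℝ) (t : ι → ℝ)
    (φ : C(SFT A, ℝ)) (ρ B K θ : ℝ) : Prop where
  normalized : NormalizedTransfer A ((lam t)⁻¹ • expWeight F₀ f t) (ℓ t) ρ B
  rate : NormalizedTransfer.DecayRate ((lam t)⁻¹ • expWeight F₀ f t) (ℓ t) ρ B K θ
  cone : LogHolderCone ρ B 0 φ
  lower : ∃ c, 0 < c ∧ ∀ x, c ≤ φ x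
  eigen : transferC (expWeight F₀ f t) φ = lam t • φ
  norm : ℓ t φ = 1

variable {F₀ : C(SFT A, ℝ)} {f : ι → C(SFT A, ℝ)} {ℓ : (ι → ℝ) → C(SFT A, ℝ) →L[ℝ] ℝ}
  {lam : (ι → ℝ) → ℝ} {t : ι → ℝ} {φ : C(SFT A, ℝ)} {ρ B K θ : ℝ}

namespace GibbsFamily

theorem const_le (G : GibbsFamily F₀ f ℓ lam) (s : ι → ℝ) {g : C(SFT A, ℝ)} {c : ℝ}
    (hc : ∀ x, c ≤ g x) : c ≤ ℓ s g := by
  have := G.pos s (g - c • 1) fun x => by simpa using hc x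
  rw [map_sub, map_smul, G.one, smul_eq_mul, mul_one] at this
  linarith

theorem norm_le_one (G : GibbsFamily F₀ f ℓ lam) (s : ι → ℝ) : ‖ℓ s‖ ≤ 1 := by
  refine ContinuousLinearMap.opNorm_le_bound _ zero_le_one fun g => ?_
  have h1 := G.const_le s (g := g) fun x => (abs_le.1 (g.norm_coe_le_norm x)).1
  have h2 := G.const_le s (g := -g) (c := -‖g‖) fun x => by
    simpa using (abs_le.1 (g.norm_coe_le_norm x)).2
  rw [map_neg] at h2
  rw [one_mul, Real.norm_eq_abs, abs_le]
  constructor <;> linarith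

theorem tendsto_transferC_sub (F₀ : C(SFT A, ℝ)) (f : ι → C(SFT A, ℝ)) (t : ι → ℝ)
    (h : C(SFT A, ℝ)) :
    Tendsto (fun s => transferC (expWeight F₀ f s) h - transferC (expWeight F₀ f t) h)
      (𝓝 t) (𝓝 0) := by
  obtain ⟨W, hW, -⟩ := exists_hasFDerivAt_transferC F₀ f t h
  simpa using (hW.continuousAt.tendsto).sub_const (transferC (expWeight F₀ f t) h)

theorem tendsto_apply_zero (G : GibbsFamily F₀ f ℓ lam) {w : (ι → ℝ) → C(SFT A, ℝ)}
    (hw : Tendsto w (𝓝 t) (𝓝 0)) : Tendsto (fun s => ℓ s (w s)) (𝓝 t) (𝓝 0) :=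
  squeeze_zero_norm (fun s => by
    simpa using (ℓ s).le_of_opNorm_le (G.norm_le_one s) (w s)) (by simpa using hw.norm)

theorem lam_sub (G : GibbsFamily F₀ f ℓ lam) (H : EigenAt F₀ f ℓ lam t φ ρ B K θ) (s : ι → ℝ) :
    lam s - lam t = ((ℓ s φ)⁻¹ • ℓ s)
      (transferC (expWeight F₀ f s) φ - transferC (expWeight F₀ f t) φ) := by
  obtain ⟨c, hc, hcφ⟩ := H.lower
  have : 0 < ℓ s φ := hc.trans_le (G.const_le s hcφ)
  rw [smul_apply, map_sub, G.eigen, H.eigen, map_smul]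
  simp only [smul_eq_mul]
  field_simp

theorem tendsto_lam (G : GibbsFamily F₀ f ℓ lam) (H : EigenAt F₀ f ℓ lam t φ ρ B K θ) :
    Tendsto lam (𝓝 t) (𝓝 (lam t)) := by
  obtain ⟨c, hc, hcφ⟩ := H.lower
  rw [tendsto_iff_norm_sub_tendsto_zero]
  have h0 := (tendsto_transferC_sub F₀ f t φ).norm.const_mul c⁻¹
  rw [norm_zero, mul_zero] at h0
  refine squeeze_zero (fun _ => norm_nonneg _) (fun s => ?_) h0
  rw [G.lam_sub H s, smul_apply, norm_smul]
  have hs : c ≤ ℓ s φ := G.const_le s hcφ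
  have h1 : ‖(ℓ s φ)⁻¹‖ ≤ c⁻¹ := by
    rw [norm_inv, Real.norm_of_nonneg (hc.le.trans hs)]
    exact inv_anti₀ hc hs
  have h2 := (ℓ s).le_of_opNorm_le (G.norm_le_one s)
    (transferC (expWeight F₀ f s) φ - transferC (expWeight F₀ f t) φ)
  rw [one_mul] at h2
  exact mul_le_mul h1 h2 (norm_nonneg _) (by positivity)

/-- The exact first-order comparison of `ℓ s g` and `ℓ t g` through the Poisson equation. -/
theorem apply_sub_eq (G : GibbsFamily F₀ f ℓ lam) (H : EigenAt F₀ f ℓ lam t φ ρ B K θ)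
    {n : ℕ} {g : C(SFT A, ℝ)} (hg : LogHolderCone ρ B n g) (s : ι → ℝ) :
    ℓ s g - ℓ t g = (lam t)⁻¹ * ℓ s
      ((transferC (expWeight F₀ f s)
          (NormalizedTransfer.poisson ((lam t)⁻¹ • expWeight F₀ f t) (ℓ t) g) -
        transferC (expWeight F₀ f t)
          (NormalizedTransfer.poisson ((lam t)⁻¹ • expWeight F₀ f t) (ℓ t) g)) -
        (lam s - lam t) • NormalizedTransfer.poisson ((lam t)⁻¹ • expWeight F₀ f t) (ℓ t) g) := by
  have h1 := H.normalized.poisson_sub H.rate hg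
  set h := NormalizedTransfer.poisson ((lam t)⁻¹ • expWeight F₀ f t) (ℓ t) g
  have hl := (G.lam_pos t).ne'
  have h2 := congrArg (ℓ s) h1
  rw [transferC_smul, smul_apply, map_sub, map_sub, map_smul, map_smul, G.one] at h2
  simp only [map_sub, map_smul, G.eigen, smul_eq_mul] at h2 ⊢
  rw [mul_one] at h2
  rw [← h2]
  field_simp
  ring

theorem tendsto_apply_of_cone (G : GibbsFamily F₀ f ℓ lam)
    (H : EigenAt F₀ f ℓ lam t φ ρ B K θ) {n : ℕ} {g : C(SFT A, ℝ)}
    (hg : LogHolderCone ρ B n g) : Tendsto (fun s => ℓ s g) (𝓝 t) (𝓝 (ℓ t g)) := by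
  rw [← tendsto_sub_nhds_zero_iff]
  simp only [G.apply_sub_eq H hg]
  set h := NormalizedTransfer.poisson ((lam t)⁻¹ • expWeight F₀ f t) (ℓ t) g
  have h1 : Tendsto (fun s => (lam s - lam t) • h) (𝓝 t) (𝓝 0) := by
    simpa using ((G.tendsto_lam H).sub_const (lam t)).smul_const h
  have h2 : Tendsto (fun s => transferC (expWeight F₀ f s) h - transferC (expWeight F₀ f t) h -
      (lam s - lam t) • h) (𝓝 t) (𝓝 0) := by
    simpa only [sub_zero] using (tendsto_transferC_sub F₀ f t h).sub h1
  simpa only [mul_zero] using (G.tendsto_apply_zero h2).const_mul (lam t)⁻¹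

end GibbsFamily

/-- The functions depending on finitely many coordinates. -/
def cylinderFunctions (A : Fin a → Fin a → Bool) : Subalgebra ℝ C(SFT A, ℝ) where
  carrier := {g | ∃ n, ∀ x y : SFT A, (∀ j < n, x.1 j = y.1 j) → g x = g y}
  mul_mem' := by
    rintro g h ⟨n, hn⟩ ⟨m, hm⟩
    refine ⟨max n m, fun x y hxy => ?_⟩
    rw [ContinuousMap.mul_apply, ContinuousMap.mul_apply,
      hn x y fun j hj => hxy j (hj.trans_le (le_max_left _ _)),
      hm x y fun j hj => hxy j (hj.trans_le (le_max_right _ _))]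
  add_mem' := by
    rintro g h ⟨n, hn⟩ ⟨m, hm⟩
    refine ⟨max n m, fun x y hxy => ?_⟩
    rw [ContinuousMap.add_apply, ContinuousMap.add_apply,
      hn x y fun j hj => hxy j (hj.trans_le (le_max_left _ _)),
      hm x y fun j hj => hxy j (hj.trans_le (le_max_right _ _))]
  algebraMap_mem' r := ⟨0, fun _ _ _ => rfl⟩

theorem cylinderFunctions_separatesPoints : (cylinderFunctions A).SeparatesPoints := by
  intro x y hxy
  obtain ⟨n, hn⟩ : ∃ n, x.1 n ≠ y.1 n := by
    by_contra! h
    exact hxy (Subtype.ext (funext h))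
  let g : C(SFT A, ℝ) := ⟨fun z => if z.1 n = x.1 n then 1 else 0,
    (continuous_of_discreteTopology (f := fun j : Fin a => if j = x.1 n then (1 : ℝ) else 0)).comp
      (continuous_coord n)⟩
  refine ⟨g, ⟨g, ⟨n + 1, fun z z' hz => ?_⟩, rfl⟩, ?_⟩
  · simp [g, hz n (Nat.lt_succ_self n)]
  · simp [g, hn.symm]

namespace GibbsFamily

theorem tendsto_apply (G : GibbsFamily F₀ f ℓ lam) (H : EigenAt F₀ f ℓ lam t φ ρ B K θ)
    (g : C(SFT A, ℝ)) : Tendsto (fun s => ℓ s g) (𝓝 t) (𝓝 (ℓ t g)) := by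
  have hdense : g ∈ closure (cylinderFunctions A : Set C(SFT A, ℝ)) := by
    rw [← Subalgebra.topologicalClosure_coe,
      ContinuousMap.subalgebra_topologicalClosure_eq_top_of_separatesPoints _
        cylinderFunctions_separatesPoints]
    trivial
  rw [Metric.tendsto_nhds]
  intro ε hε
  obtain ⟨u, ⟨n, hn⟩, hu⟩ := Metric.mem_closure_iff.1 hdense (ε / 3) (by positivity)
  have hcone : LogHolderCone ρ B n (u + ‖u‖ • (1 : C(SFT A, ℝ))) :=
    .of_locallyConstant H.normalized.ρ_pos.le H.normalized.B_pos.le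
      (fun x => by
        have := (abs_le.1 (u.norm_coe_le_norm x)).1
        simp only [ContinuousMap.add_apply, ContinuousMap.smul_apply, ContinuousMap.one_apply,
          smul_eq_mul, mul_one]
        linarith)
      (fun x y hxy => by simp [hn x y hxy])
  have hlim := Metric.tendsto_nhds.1 (G.tendsto_apply_of_cone H hcone) (ε / 3) (by positivity)
  filter_upwards [hlim] with s hs
  have hclose : ∀ s, |ℓ s g - ℓ s u| < ε / 3 := fun s => by
    rw [← map_sub]
    refine lt_of_le_of_lt ((ℓ s).le_of_opNorm_le (G.norm_le_one s) _) ?_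
    rwa [one_mul, ← dist_eq_norm]
  simp only [map_add, map_smul, G.one, Real.dist_eq, add_sub_add_right_eq_sub] at hs ⊢
  have h1 := abs_lt.1 (hclose s)
  have h2 := abs_lt.1 (hclose t)
  have h3 := abs_lt.1 hs
  rw [abs_lt]
  constructor <;> linarith

theorem exists_hasFDerivAt_lam (G : GibbsFamily F₀ f ℓ lam)
    (H : EigenAt F₀ f ℓ lam t φ ρ B K θ) :
    ∃ Λ : (ι → ℝ) →L[ℝ] ℝ, HasFDerivAt lam Λ t ∧ ∀ v, Λ v = lam t * ℓ t (linPot f v * φ) := by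
  obtain ⟨c, hc, hcφ⟩ := H.lower
  obtain ⟨W, hW, hWv⟩ := exists_hasFDerivAt_transferC F₀ f t φ
  have hbd : ∀ s, ‖(ℓ s φ)⁻¹ • ℓ s‖ ≤ c⁻¹ := fun s => by
    have hs : c ≤ ℓ s φ := G.const_le s hcφ
    refine ContinuousLinearMap.opNorm_le_bound _ (by positivity) fun e => ?_
    have he := (ℓ s).le_of_opNorm_le (G.norm_le_one s) e
    rw [one_mul] at he
    rw [smul_apply, norm_smul, norm_inv, Real.norm_of_nonneg (hc.le.trans hs)]
    exact mul_le_mul (inv_anti₀ hc hs) he (norm_nonneg _) (by positivity)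
  have hlim : ∀ e, Tendsto (fun s => ((ℓ s φ)⁻¹ • ℓ s) e) (𝓝 t) (𝓝 (((ℓ t φ)⁻¹ • ℓ t) e)) :=
    fun e => ((G.tendsto_apply H φ).inv₀ (by rw [H.norm]; exact one_ne_zero)).mul
      (G.tendsto_apply H e)
  have hD := hasFDerivAt_apply_of_eq_zero hbd hlim
    (hW.sub_const (transferC (expWeight F₀ f t) φ)) (sub_self _)
  simp only [← G.lam_sub H] at hD
  refine ⟨_, by simpa using hD.add_const (lam t), fun v => ?_⟩
  simp [hWv, H.norm, G.eigen]

/-- The derivative of `s ↦ ℓ s g` at `t`, for `g` in the cone. -/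
theorem exists_hasFDerivAt_apply (G : GibbsFamily F₀ f ℓ lam)
    (H : EigenAt F₀ f ℓ lam t φ ρ B K θ) {n : ℕ} {g : C(SFT A, ℝ)}
    (hg : LogHolderCone ρ B n g) :
    ∃ D : (ι → ℝ) →L[ℝ] ℝ, HasFDerivAt (fun s => ℓ s g) D t ∧
      ∀ v, D v = ℓ t ((linPot f v - ℓ t (linPot f v * φ) • (1 : C(SFT A, ℝ))) *
        NormalizedTransfer.poisson ((lam t)⁻¹ • expWeight F₀ f t) (ℓ t) g) := by
  have hsub := G.apply_sub_eq H hg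
  set h := NormalizedTransfer.poisson ((lam t)⁻¹ • expWeight F₀ f t) (ℓ t) g
  obtain ⟨W, hW, hWv⟩ := exists_hasFDerivAt_transferC F₀ f t h
  obtain ⟨Λ, hΛ, hΛv⟩ := G.exists_hasFDerivAt_lam H
  have hD := hasFDerivAt_apply_of_eq_zero G.norm_le_one (G.tendsto_apply H)
    ((hW.sub_const (transferC (expWeight F₀ f t) h)).sub
      ((hΛ.sub_const (lam t)).smul_const h)) (by simp)
  have hD2 := (hD.const_mul (lam t)⁻¹).add_const (ℓ t g)
  refine ⟨_, hD2.congr_of_eventuallyEq (Eventually.of_forall fun s => ?_), fun v => ?_⟩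
  · change _ = (lam t)⁻¹ * ℓ s _ + ℓ t g
    rw [← sub_eq_iff_eq_add]
    exact hsub s
  · have hl := (G.lam_pos t).ne'
    simp only [smul_apply, ContinuousLinearMap.comp_apply, sub_apply,
      ContinuousLinearMap.smulRight_apply, hWv, hΛv, map_sub, map_smul, G.eigen, smul_eq_mul,
      sub_mul, smul_mul_assoc, one_mul]
    field_simp

/-- Comparison of the derivative of `s ↦ ℓ s g` with a centered Birkhoff sum. -/
theorem exists_derivative_bound (G : GibbsFamily F₀ f ℓ lam)
    (H : EigenAt F₀ f ℓ lam t φ ρ B K θ) (v : ι → ℝ) :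
    ∃ K', ∀ n, ∀ g : C(SFT A, ℝ), LogHolderCone ρ B n g →
      |fderiv ℝ (fun s => ℓ s g) t v - ∑ k ∈ Finset.range n,
        ℓ t ((linPot f v - ℓ t (linPot f v * φ) • (1 : C(SFT A, ℝ))).comp
          ⟨_, (shiftC A).continuous.iterate k⟩ * g)| ≤ K' * ℓ t g := by
  set u := linPot f v - ℓ t (linPot f v * φ) • (1 : C(SFT A, ℝ)) with hu
  let T : C(SFT A, ℝ) →L[ℝ] ℝ := (ℓ t).comp (ContinuousLinearMap.mul ℝ C(SFT A, ℝ) u)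
  have hT : T φ = 0 := by
    change ℓ t (u * φ) = 0
    simp [hu, sub_mul, H.norm]
  have hφ : transferC ((lam t)⁻¹ • expWeight F₀ f t) φ = φ := by
    rw [transferC_smul, smul_apply, H.eigen, inv_smul_smul₀ (G.lam_pos t).ne']
  refine ⟨‖T‖ * (3 * K * (1 - θ)⁻¹), fun n g hg => ?_⟩
  obtain ⟨D, hD, hDv⟩ := G.exists_hasFDerivAt_apply H hg
  have := H.normalized.abs_apply_poisson_sub_le H.rate H.cone hφ H.norm hT hg
  rw [hD.fderiv, hDv]
  simp only [← H.normalized.apply_mul_pow]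
  exact this

end GibbsFamily

end Family

section HolderSeq

variable {a : ℕ} {f g : (ℕ → Fin a) → ℝ}

theorem HolderSeq.exists_bound (hf : HolderSeq f) :
    ∃ C ρ : ℝ, 0 ≤ C ∧ 0 < ρ ∧ ρ < 1 ∧ ∀ ρ', ρ ≤ ρ' →
      ∀ n, ∀ x y : ℕ → Fin a, (∀ i < n, x i = y i) → |f x - f y| ≤ C * ρ' ^ n := by
  obtain ⟨-, C, ρ, hρ0, hρ1, hC⟩ := hf
  refine ⟨|C|, ρ, abs_nonneg C, hρ0, hρ1, fun ρ' hρ' n x y hxy => (hC n x y hxy).trans ?_⟩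
  gcongr
  exact le_abs_self C

theorem HolderSeq.zero : HolderSeq (0 : (ℕ → Fin a) → ℝ) :=
  ⟨continuous_zero, 0, 2⁻¹, by norm_num, by norm_num, fun _ _ _ _ => by simp⟩

theorem HolderSeq.add (hf : HolderSeq f) (hg : HolderSeq g) : HolderSeq (f + g) := by
  obtain ⟨C, ρ, -, hρ0, hρ1, hC⟩ := hf.exists_bound
  obtain ⟨D, τ, -, -, hτ1, hD⟩ := hg.exists_bound
  refine ⟨hf.1.add hg.1, C + D, max ρ τ, lt_max_of_lt_left hρ0, max_lt hρ1 hτ1,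
    fun n x y hxy => ?_⟩
  have h1 := abs_le.1 (hC _ (le_max_left ρ τ) n x y hxy)
  have h2 := abs_le.1 (hD _ (le_max_right ρ τ) n x y hxy)
  rw [Pi.add_apply, Pi.add_apply, add_mul, abs_le]
  constructor <;> linarith

theorem HolderSeq.const_smul (hf : HolderSeq f) (r : ℝ) : HolderSeq (r • f) := by
  obtain ⟨C, ρ, -, hρ0, hρ1, hC⟩ := hf.exists_bound
  refine ⟨hf.1.const_smul r, |r| * C, ρ, hρ0, hρ1, fun n x y hxy => ?_⟩
  rw [Pi.smul_apply, Pi.smul_apply, smul_eq_mul, smul_eq_mul, ← mul_sub, abs_mul, mul_assoc]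
  exact mul_le_mul_of_nonneg_left (hC ρ le_rfl n x y hxy) (abs_nonneg r)

theorem HolderSeq.Fpot {d : ℕ} {f₀ : (ℕ → Fin a) → ℝ} {f : Fin d → (ℕ → Fin a) → ℝ}
    (hf₀ : HolderSeq f₀) (hf : ∀ i, HolderSeq (f i)) (s : Fin d → ℝ) :
    HolderSeq (Fpot f₀ f s) := by
  have h : GibbsPaper.Fpot f₀ f s = f₀ + ∑ i, s i • f i := by
    funext x
    simp [GibbsPaper.Fpot]
  rw [h]
  exact hf₀.add (Finset.sum_induction _ HolderSeq (fun _ _ h1 h2 => h1.add h2) .zero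
    fun i _ => (hf i).const_smul (s i))

end HolderSeq

section Bridge

variable {a d : ℕ} {A : Fin a → Fin a → Bool}

/-- The restriction to the subshift of a continuous function on the sequence space. -/
def restrictC (A : Fin a → Fin a → Bool) (g : (ℕ → Fin a) → ℝ) (hg : Continuous g) :
    C(SFT A, ℝ) :=
  ⟨fun x => g x.1, hg.comp continuous_subtype_val⟩

theorem exists_integral_functional {ν : Measure (ℕ → Fin a)} [IsProbabilityMeasure ν]
    (h0 : ν (SFT A)ᶜ = 0) :
    ∃ L : C(SFT A, ℝ) →L[ℝ] ℝ, ∀ (h : C(SFT A, ℝ)) (g : (ℕ → Fin a) → ℝ),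
      (∀ x : SFT A, h x = g x.1) → L h = ∫ x, g x ∂ν := by
  have hS : MeasurableSet (SFT A) := (isClosed_SFT A).measurableSet
  have hae : ∀ᵐ x ∂ν, x ∈ SFT A := h0
  let m : Measure (SFT A) := ν.comap Subtype.val
  have hm : IsFiniteMeasure m := ⟨by
    rw [(MeasurableEmbedding.subtype_coe hS).comap_apply]
    exact measure_lt_top _ _⟩
  have hint : ∀ h : C(SFT A, ℝ), Integrable h m := fun h =>
    h.continuous.integrable_of_hasCompactSupport (HasCompactSupport.of_compactSpace h)
  let L₀ : C(SFT A, ℝ) →ₗ[ℝ] ℝ :=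
    { toFun := fun h => ∫ x, h x ∂m
      map_add' := fun h h' => integral_add (hint h) (hint h')
      map_smul' := fun r h => integral_const_mul r h }
  refine ⟨L₀.mkContinuous (m.real Set.univ) fun h => ?_, fun h g hhg => ?_⟩
  · rw [mul_comm]
    exact norm_integral_le_of_norm_le_const (Eventually.of_forall h.norm_coe_le_norm)
  · change ∫ x, h x ∂m = _
    simp only [hhg]
    rw [integral_subtype_comap hS, Measure.restrict_eq_self_of_ae_mem hae]

variable {f₀ : (ℕ → Fin a) → ℝ} {f : Fin d → (ℕ → Fin a) → ℝ}

theorem linPot_restrictC (hf : ∀ i, Continuous (f i)) (s : Fin d → ℝ) (x : SFT A) :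
    linPot (fun i => restrictC A (f i) (hf i)) s x = ∑ i, s i * f i x.1 := by
  rw [linPot_apply, ContinuousMap.sum_apply]
  rfl

theorem expWeight_restrictC (hf₀ : Continuous f₀) (hf : ∀ i, Continuous (f i)) (s : Fin d → ℝ)
    (x : SFT A) :
    expWeight (restrictC A f₀ hf₀) (fun i => restrictC A (f i) (hf i)) s x =
      Real.exp (Fpot f₀ f s x.1) := by
  rw [expWeight, exp_apply, ContinuousMap.add_apply, linPot_restrictC hf]
  rfl

theorem transferC_expWeight_apply (hf₀ : Continuous f₀) (hf : ∀ i, Continuous (f i)) (s : Fin d → ℝ)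
    {h : C(SFT A, ℝ)} {g : (ℕ → Fin a) → ℝ} (hhg : ∀ x : SFT A, h x = g x.1) (x : SFT A) :
    transferC (expWeight (restrictC A f₀ hf₀) (fun i => restrictC A (f i) (hf i)) s) h x =
      transfer A (Fpot f₀ f s) g x.1 := by
  rw [transferC_apply, transfer]
  refine Finset.sum_congr rfl fun i _ => ?_
  split_ifs with hi
  · rw [expWeight_restrictC hf₀ hf, hhg, branch_val hi]
  · rfl

theorem exists_gibbsFamily (G : GibbsData a A) (hf₀ : HolderSeq f₀) (hf : ∀ i, HolderSeq (f i)) :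
    ∃ ℓ : (Fin d → ℝ) → C(SFT A, ℝ) →L[ℝ] ℝ,
      GibbsFamily (restrictC A f₀ hf₀.1) (fun i => restrictC A (f i) (hf i).1) ℓ
        (fun s => Real.exp (G.P (Fpot f₀ f s))) ∧
      ∀ s (h : C(SFT A, ℝ)) (g : (ℕ → Fin a) → ℝ), (∀ x : SFT A, h x = g x.1) →
        ℓ s h = ∫ x, g x ∂(G.ν (Fpot f₀ f s)) := by
  have hE := fun s => G.eigen _ (hf₀.Fpot hf s)
  have hprob := fun s => (hE s).1
  choose ℓ hℓ using fun s => exists_integral_functional (hE s).2.1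
  have hext : ∀ h : C(SFT A, ℝ), ∃ g : C(ℕ → Fin a, ℝ), ∀ x : SFT A, h x = g x.1 := fun h => by
    obtain ⟨g, hg⟩ := h.exists_restrict_eq (isClosed_SFT A)
    exact ⟨g, fun x => by rw [← hg]; rfl⟩
  refine ⟨ℓ, ⟨fun s g hg => ?_, fun s => ?_, fun s => Real.exp_pos _, fun s g => ?_⟩, hℓ⟩
  · obtain ⟨g', hg'⟩ := hext g
    rw [hℓ s g (fun x => |g' x|) fun x => by rw [← hg', abs_of_nonneg (hg x)]]
    exact integral_nonneg fun x => abs_nonneg _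
  · rw [hℓ s 1 (fun _ => 1) fun _ => rfl]
    simp
  · obtain ⟨g', hg'⟩ := hext g
    rw [hℓ s g g' hg', hℓ s _ _ (transferC_expWeight_apply hf₀.1 (fun i => (hf i).1) s hg'),
      (hE s).2.2 g' g'.continuous]

theorem exists_pos_le (φ : C(SFT A, ℝ)) (hφ : ∀ x, 0 < φ x) : ∃ c, 0 < c ∧ ∀ x, c ≤ φ x := by
  rcases isEmpty_or_nonempty (SFT A) with h | h
  · exact ⟨1, one_pos, fun x => h.elim x⟩
  · obtain ⟨x, -, hx⟩ := isCompact_univ.exists_isMinOn Set.univ_nonempty φ.continuous.continuousOn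
    exact ⟨φ x, hφ x, fun y => hx (Set.mem_univ y)⟩

theorem exists_eigenAt (hmix : Mixing A) (G : GibbsData a A) (hf₀ : HolderSeq f₀)
    (hf : ∀ i, HolderSeq (f i)) (t : Fin d → ℝ) {ℓ : (Fin d → ℝ) → C(SFT A, ℝ) →L[ℝ] ℝ}
    (hG : GibbsFamily (restrictC A f₀ hf₀.1) (fun i => restrictC A (f i) (hf i).1) ℓ
      (fun s => Real.exp (G.P (Fpot f₀ f s))))
    (hℓ : ∀ s (h : C(SFT A, ℝ)) (g : (ℕ → Fin a) → ℝ), (∀ x : SFT A, h x = g x.1) →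
      ℓ s h = ∫ x, g x ∂(G.ν (Fpot f₀ f s))) :
    ∃ (φ : C(SFT A, ℝ)) (ρ B K θ : ℝ),
      EigenAt (restrictC A f₀ hf₀.1) (fun i => restrictC A (f i) (hf i).1) ℓ
        (fun s => Real.exp (G.P (Fpot f₀ f s))) t φ ρ B K θ ∧
      ∀ x, φ x = G.φ (Fpot f₀ f t) x.1 := by
  have hF := hf₀.Fpot hf t
  have hφh := G.φ_holder _ hF
  let φ := restrictC A _ hφh.1
  obtain ⟨C, ρ, hC0, hρ0, hρ1, hC⟩ := hF.exists_bound
  obtain ⟨D, τ, hD0, -, hτ1, hD⟩ := hφh.exists_bound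
  obtain ⟨c, hc, hcφ⟩ := exists_pos_le φ fun x => G.φ_pos _ hF x.1 x.2
  set F₀ := restrictC A f₀ hf₀.1
  set fc : Fin d → C(SFT A, ℝ) := fun i => restrictC A (f i) (hf i).1
  set r := max ρ τ
  have hr0 : 0 < r := lt_max_of_lt_left hρ0
  have hr1 : r < 1 := max_lt hρ1 hτ1
  set B := r * C / (1 - r) + D / c + 1
  have hr1' : 0 < 1 - r := sub_pos.2 hr1
  have hDB : D / c ≤ B := by
    have : 0 ≤ r * C / (1 - r) := by positivity
    linarith
  have hrB : r * (B + C) < B := by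
    have h1 : r * C / (1 - r) < B := by
      have : 0 ≤ D / c := by positivity
      linarith
    rw [div_lt_iff₀ hr1'] at h1
    linarith
  obtain ⟨w, hw, hwψ⟩ := exists_pos_le (expWeight F₀ fc t) fun x => by
    rw [expWeight_restrictC hf₀.1 fun i => (hf i).1]
    exact Real.exp_pos _
  have hl := Real.exp_pos (G.P (Fpot f₀ f t))
  have hN : NormalizedTransfer A ((Real.exp (G.P (Fpot f₀ f t)))⁻¹ • expWeight F₀ fc t) (ℓ t) r B :=
    { ρ_pos := hr0
      ρ_lt := hr1
      weight := ⟨(Real.exp (G.P (Fpot f₀ f t)))⁻¹ * w, by positivity, fun x =>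
        mul_le_mul_of_nonneg_left (hwψ x) (by positivity)⟩
      logHolder := by
        refine ⟨C, hC0, hrB, fun k x y hxy => ?_⟩
        rw [ContinuousMap.smul_apply, ContinuousMap.smul_apply, smul_eq_mul, smul_eq_mul,
          mul_assoc, expWeight_restrictC hf₀.1 fun i => (hf i).1,
          expWeight_restrictC hf₀.1 fun i => (hf i).1, ← Real.exp_add]
        have := (abs_le.1 (hC r (le_max_left ρ τ) k x.1 y.1 hxy)).2
        gcongr
        linarith
      pos := hG.pos t
      one := hG.one t
      invariant := fun g => by
        rw [transferC_smul, smul_apply, map_smul, hG.eigen, smul_eq_mul,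
          inv_mul_cancel_left₀ hl.ne'] }
  obtain ⟨K, θ, hK, hθ0, hθ1, hdecay⟩ := hN.exists_decay hmix
  refine ⟨φ, r, B, K, θ, ⟨hN, ⟨hK, hθ0, hθ1, hdecay⟩, ?_, ⟨c, hc, hcφ⟩, ?_, ?_⟩, fun x => rfl⟩
  · exact .of_holder hr0.le hc hD0 hcφ
      (fun k x y hxy => hD r (le_max_right ρ τ) k x.1 y.1 hxy) hDB
  · ext x
    rw [transferC_expWeight_apply hf₀.1 (fun i => (hf i).1) t (g := G.φ (Fpot f₀ f t)) (fun _ => rfl),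
      G.φ_eigen _ hF x.1 x.2]
    rfl
  · rw [hℓ t φ _ fun _ => rfl, G.φ_norm _ hF]

/-- The indicator function of a cylinder. -/
noncomputable def cylC (A : Fin a → Fin a → Bool) (n : ℕ) (c : ℕ → Fin a) : C(SFT A, ℝ) where
  toFun x := if ∀ i < n, x.1 i = c i then 1 else 0
  continuous_toFun := by
    have h : ∀ x : SFT A, (if ∀ i < n, x.1 i = c i then (1 : ℝ) else 0) =
        ∏ i ∈ Finset.range n, if x.1 i = c i then 1 else 0 := fun x => by
      rw [Finset.prod_ite_zero]
      simp
    simp only [h]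
    exact continuous_finsetProd _ fun i _ => (continuous_of_discreteTopology
      (f := fun j : Fin a => if j = c i then (1 : ℝ) else 0)).comp (continuous_coord i)

theorem logHolderCone_cylC {ρ B : ℝ} (hρ : 0 ≤ ρ) (hB : 0 ≤ B) (n : ℕ) (c : ℕ → Fin a) :
    LogHolderCone ρ B n (cylC A n c) :=
  .of_locallyConstant hρ hB (fun x => by simp only [cylC, ContinuousMap.coe_mk]; split_ifs <;> simp)
    fun x y hxy => by
      simp only [cylC, ContinuousMap.coe_mk]
      refine if_congr (forall₂_congr fun i hi => by rw [hxy i hi]) rfl rfl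

theorem measurableSet_cyl (n : ℕ) (c : ℕ → Fin a) : MeasurableSet (cyl A n c) := by
  have h : cyl A n c = SFT A ∩ ⋂ i < n, (fun x : ℕ → Fin a => x i) ⁻¹' {c i} := by
    ext x
    simp [cyl]
  rw [h]
  exact (isClosed_SFT A).measurableSet.inter <| .iInter fun i => .iInter fun _ =>
    measurable_pi_apply i (measurableSet_singleton _)

theorem mul_cylC_apply (h : C(SFT A, ℝ)) {g : (ℕ → Fin a) → ℝ} (hhg : ∀ x : SFT A, h x = g x.1)
    (n : ℕ) (c : ℕ → Fin a) (x : SFT A) :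
    (h * cylC A n c) x = (cyl A n c).indicator g x.1 := by
  classical
  rw [ContinuousMap.mul_apply, Set.indicator_apply, hhg]
  simp [cylC, cyl, x.2]

theorem shiftC_iterate_coe (k : ℕ) (x : SFT A) : ((shiftC A)^[k] x).1 = shift^[k] x.1 := by
  induction k generalizing x with
  | zero => rfl
  | succ k ih => rw [Function.iterate_succ_apply, Function.iterate_succ_apply, ih]; rfl

end Bridge

/-- **Lemma 3.3 (1).** Fix `t ∈ ℝ^d` and `i`.  The map `s ↦ ν_s(C)` is differentiable
for every cylinder `C`, and there is a constant `K = K(t) < ∞`, independent of `n` and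
of the cylinder, such that for all `n ≥ 1` and every cylinder `C = [c₀,…,c_{n−1}]`,
`| ∂ν_s(C)/∂s_i |_{s=t} − ∫_C (S_n f_i − n ∫ f_i dμ_t) dν_t | ≤ K ν_t(C)`. -/
theorem lemma_3_3_first_derivative_of_cylinder_measure
    {a d : ℕ} (ha : 2 ≤ a) (A : Fin a → Fin a → Bool) (hmix : Mixing A)
    (G : GibbsData a A)
    (f₀ : (ℕ → Fin a) → ℝ) (f : Fin d → (ℕ → Fin a) → ℝ)
    (hf₀ : HolderSeq f₀) (hf : ∀ i, HolderSeq (f i))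
    (t : Fin d → ℝ) (i : Fin d) :
    (∀ n : ℕ, ∀ c : ℕ → Fin a,
      Differentiable ℝ (fun s : Fin d → ℝ => (G.ν (Fpot f₀ f s) (cyl A n c)).toReal)) ∧
    ∃ K : ℝ, ∀ n : ℕ, 1 ≤ n → ∀ c : ℕ → Fin a,
      |fderiv ℝ (fun s : Fin d → ℝ => (G.ν (Fpot f₀ f s) (cyl A n c)).toReal) t
          (Pi.single i 1) -
        ∫ x in cyl A n c,
          (birkhoff n (f i) x - (n : ℝ) * ∫ z, f i z ∂(G.μ (Fpot f₀ f t)))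
            ∂(G.ν (Fpot f₀ f t))| ≤
      K * (G.ν (Fpot f₀ f t) (cyl A n c)).toReal := by
  obtain ⟨ℓ, hG, hℓ⟩ := exists_gibbsFamily G hf₀ hf
  have hcyl : ∀ s n c, (G.ν (Fpot f₀ f s) (cyl A n c)).toReal = ℓ s (cylC A n c) := fun s n c => by
    have h := hℓ s (1 * cylC A n c) _ (mul_cylC_apply 1 (g := 1) (fun _ => rfl) n c)
    rw [one_mul, integral_indicator_one (measurableSet_cyl n c)] at h
    exact h.symm
  simp only [hcyl]
  refine ⟨fun n c s => ?_, ?_⟩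
  · obtain ⟨φ, ρ, B, K, θ, H, -⟩ := exists_eigenAt hmix G hf₀ hf s hG hℓ
    obtain ⟨D, hD, -⟩ := hG.exists_hasFDerivAt_apply H
      (logHolderCone_cylC H.normalized.ρ_pos.le H.normalized.B_pos.le n c)
    exact hD.differentiableAt
  obtain ⟨φ, ρ, B, K, θ, H, hφ⟩ := exists_eigenAt hmix G hf₀ hf t hG hℓ
  obtain ⟨K', hK'⟩ := hG.exists_derivative_bound H (Pi.single i 1)
  refine ⟨K', fun n _ c => ?_⟩
  have hv : linPot (fun i => restrictC A (f i) (hf i).1) (Pi.single i 1) =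
      restrictC A (f i) (hf i).1 := by
    rw [linPot_apply, Finset.sum_eq_single i] <;> simp +contextual
  have hF := hf₀.Fpot hf t
  have hm : ℓ t (restrictC A (f i) (hf i).1 * φ) = ∫ z, f i z ∂(G.μ (Fpot f₀ f t)) := by
    rw [GibbsData.μ, integral_withDensity_eq_integral_toReal_smul
      (G.φ_holder _ hF).1.measurable.ennreal_ofReal
      (Eventually.of_forall fun x => ENNReal.ofReal_lt_top)]
    refine hℓ t _ _ fun x => ?_
    rw [ContinuousMap.mul_apply, hφ, ENNReal.toReal_ofReal (G.φ_pos _ hF _ x.2).le, smul_eq_mul,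
      mul_comm]
    rfl
  have hbound := hK' n (cylC A n c)
    (logHolderCone_cylC H.normalized.ρ_pos.le H.normalized.B_pos.le n c)
  rw [hv, hm, ← map_sum, ← Finset.sum_mul] at hbound
  rwa [hℓ t _ _ (mul_cylC_apply _ (g := fun x => birkhoff n (f i) x -
    (n : ℝ) * ∫ z, f i z ∂(G.μ (Fpot f₀ f t))) (fun x => ?_) n c),
    integral_indicator (measurableSet_cyl n c)] at hbound
  simp [ContinuousMap.sum_apply, birkhoff, restrictC, shiftC_iterate_coe, mul_comm]

end GibbsPaper
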